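/- arXiv:1108.2240 — 2 statements merged into one kernel-verified Lean document; each statement's English description precedes it below -/
import Mathlib

section
/- Let 0 → A →^i A →^j C → 0 be a short exact sequence of bigraded chain complexes, with H_q = colim_p A_{p,q} filtered by F_p H_q = im(A_{p,q} → H_q). Then there is a natural injective map γ: F_p H_q / F_{p-1} H_q → E^∞_{p,q}, induced by sending a class represented by a ∈ A_{p,q} to the class of j(a). -/
open Submodule

section FilteredComplex

variable {k : Type*} [CommRing k]
variable (T : ℤ → Type*) [∀ q, AddCommGroup (T q)] [∀ q, Module k (T q)]
variable (d : ∀ q : ℤ, T (q + 1) →ₗ[k] T q)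
variable (F : ℤ → ∀ q : ℤ, Submodule k (T q))

/-- cycles at (shifted) level `q`. -/
abbrev Zcyc (q : ℤ) : Submodule k (T (q + 1)) := LinearMap.ker (d q)

/-- boundaries at (shifted) level `q`. -/
abbrev Bdry (q : ℤ) : Submodule k (T (q + 1)) := LinearMap.range (d (q + 1))

/-- homology `H_q` of the (colimit = total) complex `T`. -/
abbrev Hq (q : ℤ) := ↥(Zcyc T d q) ⧸ comap (Zcyc T d q).subtype (Bdry T d q)

/-- projection onto homology. -/
abbrev πH (q : ℤ) : ↥(Zcyc T d q) →ₗ[k] Hq T d q := mkQ _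

/-- `F_p H_q`: the image of the `p`-th filtration stage in homology. -/
abbrev FH (p q : ℤ) : Submodule k (Hq T d q) :=
  map (πH T d q) (comap (Zcyc T d q).subtype (F p (q + 1)))

/-- the cycles `Z^r_{p,q} = F_p ∩ d⁻¹ F_{p-r}` (chain level). -/
abbrev Zr (r : ℕ) (p q : ℤ) : Submodule k (T (q + 1)) :=
  F p (q + 1) ⊓ comap (d q) (F (p - r) q)

/-- the same, one vertical level up. -/
abbrev ZrUp (r : ℕ) (p q : ℤ) : Submodule k (T (q + 1 + 1)) :=
  F p (q + 1 + 1) ⊓ comap (d (q + 1)) (F (p - r) (q + 1))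

/-- the boundaries `B^{s+1}_{p,q} = Z^s_{p-1} + d Z^s_{p+s}` (chain level). -/
abbrev Bpart (s : ℕ) (p q : ℤ) : Submodule k (T (q + 1)) :=
  Zr T d F s (p - 1) q ⊔ map (d (q + 1)) (ZrUp T d F s (p + s) q)

/-- the first page `E¹_{p,q} = Z¹/B¹`. -/
abbrev E1mod (p q : ℤ) :=
  ↥(Zr T d F 1 p q) ⧸ comap (Zr T d F 1 p q).subtype (Bpart T d F 0 p q)

/-- projection onto the first page. -/
abbrev πE1 (p q : ℤ) : ↥(Zr T d F 1 p q) →ₗ[k] E1mod T d F p q := mkQ _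

/-- the image `Z^{r+1}` in the first page. -/
abbrev Zbar (r : ℕ) (p q : ℤ) : Submodule k (E1mod T d F p q) :=
  map (πE1 T d F p q) (comap (Zr T d F 1 p q).subtype (Zr T d F (r + 1) p q))

/-- the image `B^{r+1}` in the first page. -/
abbrev Bbar (r : ℕ) (p q : ℤ) : Submodule k (E1mod T d F p q) :=
  map (πE1 T d F p q) (comap (Zr T d F 1 p q).subtype (Bpart T d F r p q))

/-- `E^∞_{p,q} = (∩_r Z^r)/(∪_r B^r)`. -/
abbrev Einf (p q : ℤ) :=
  ↥(⨅ r : ℕ, Zbar T d F r p q) ⧸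
    comap (⨅ r : ℕ, Zbar T d F r p q).subtype (⨆ r : ℕ, Bbar T d F r p q)

end FilteredComplex

theorem exists_factor_inj {k M N P : Type*} [CommRing k] [AddCommGroup M] [AddCommGroup N]
    [AddCommGroup P] [Module k M] [Module k N] [Module k P]
    (g : M →ₗ[k] N) (f : M →ₗ[k] P) (hg : Function.Surjective g)
    (h : ∀ x, g x = 0 ↔ f x = 0) :
    ∃ γ : N →ₗ[k] P, Function.Injective γ ∧ ∀ x, γ (g x) = f x := by
  have hle : LinearMap.ker g ≤ LinearMap.ker f := fun x hx => (h x).1 hx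
  have key : ∀ x, ((LinearMap.ker g).liftQ f hle ∘ₗ
      (g.quotKerEquivOfSurjective hg).symm.toLinearMap) (g x) = f x := by
    intro x
    have : (g.quotKerEquivOfSurjective hg).symm (g x) = Submodule.Quotient.mk x := by
      rw [LinearEquiv.symm_apply_eq]
      rfl
    simp only [LinearMap.comp_apply, LinearEquiv.coe_coe, this]
    rfl
  refine ⟨_, ?_, key⟩
  rw [injective_iff_map_eq_zero]
  intro y hy
  obtain ⟨x, rfl⟩ := hg y
  rw [key] at hy
  exact (h x).2 hy

/-- Let `0 → A →ⁱ A →ʲ C → 0` be a short exact sequence of bigraded chain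
complexes — presented here, using that `i` is injective, as an exhaustive filtration
`F` of the colimit complex `T` (so `A_{p,q} = F_p T_q` and `C_p = F_p/F_{p-1}`), with
`H_q = colim_p A_{p,q}` computed by the homology of `T` and filtered by
`F_p H_q = im (A_{p,q} → H_q)`.  Then there is a natural injective map
`γ : F_p H_q / F_{p-1} H_q → E^∞_{p,q}` induced by sending a class represented by
`a ∈ A_{p,q}` to the class of `j(a)`. -/
theorem stmt_9 {k : Type*} [CommRing k]
    (T : ℤ → Type*) [∀ q, AddCommGroup (T q)] [∀ q, Module k (T q)]
    (d : ∀ q : ℤ, T (q + 1) →ₗ[k] T q)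
    (hd : ∀ q, (d q) ∘ₗ (d (q + 1)) = 0)
    (F : ℤ → ∀ q : ℤ, Submodule k (T q))
    (hmono : ∀ p p' q, p ≤ p' → F p q ≤ F p' q)
    (hexh : ∀ q, (⨆ p, F p q) = ⊤)
    (hcompat : ∀ p q x, x ∈ F p (q + 1) → d q x ∈ F p q)
    (p q : ℤ) :
    ∃ γ : (↥(FH T d F p q) ⧸ comap (FH T d F p q).subtype (FH T d F (p - 1) q))
        →ₗ[k] Einf T d F p q,
      Function.Injective γ ∧
      -- `γ` sends the class of (the homology class of) a filtered cycle `x` to the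
      -- class of `x` (i.e. of `j x`) in `E^∞_{p,q}`
      ∀ (x : T (q + 1)) (hcyc : x ∈ Zcyc T d q) (hF : x ∈ F p (q + 1))
        (hFH : (πH T d q ⟨x, hcyc⟩) ∈ FH T d F p q)
        (hZ1 : x ∈ Zr T d F 1 p q)
        (hZb : (πE1 T d F p q ⟨x, hZ1⟩) ∈ ⨅ r : ℕ, Zbar T d F r p q),
        γ (Submodule.Quotient.mk ⟨πH T d q ⟨x, hcyc⟩, hFH⟩) =
          Submodule.Quotient.mk ⟨πE1 T d F p q ⟨x, hZ1⟩, hZb⟩ := by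
  have hpp : ∀ q, F (p - 1) q ≤ F p q := fun q => hmono _ _ _ (by omega)
  let K : Submodule k (Zcyc T d q) := comap (Zcyc T d q).subtype (F p (q + 1))
  have hZr : ∀ (r : ℕ) (x : K), (x : Zcyc T d q).1 ∈ Zr T d F r p q := by
    intro r x
    refine ⟨x.2, ?_⟩
    have h0 : d q x.1.1 = 0 := x.1.2
    show d q x.1.1 ∈ F (p - r) q
    rw [h0]
    exact zero_mem _
  let toZ1 : K →ₗ[k] Zr T d F 1 p q :=
    LinearMap.codRestrict _ ((Zcyc T d q).subtype ∘ₗ K.subtype) (hZr 1)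
  have hinf : ∀ x : K, (πE1 T d F p q ∘ₗ toZ1) x ∈ ⨅ r : ℕ, Zbar T d F r p q := by
    intro x
    rw [Submodule.mem_iInf]
    intro r
    exact ⟨toZ1 x, hZr (r + 1) x, rfl⟩
  let f : K →ₗ[k] Einf T d F p q :=
    mkQ _ ∘ₗ LinearMap.codRestrict _ (πE1 T d F p q ∘ₗ toZ1) hinf
  have hfh : ∀ x : K, (πH T d q ∘ₗ K.subtype) x ∈ FH T d F p q := fun x => ⟨x.1, x.2, rfl⟩
  let g : K →ₗ[k] (↥(FH T d F p q) ⧸ comap (FH T d F p q).subtype (FH T d F (p - 1) q)) :=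
    mkQ _ ∘ₗ LinearMap.codRestrict _ (πH T d q ∘ₗ K.subtype) hfh
  have hg : Function.Surjective g := by
    intro y
    obtain ⟨⟨_, z, hz, rfl⟩, rfl⟩ := Submodule.mkQ_surjective _ y
    exact ⟨⟨z, hz⟩, rfl⟩
  have hg0 : ∀ x : K, g x = 0 ↔ πH T d q x.1 ∈ FH T d F (p - 1) q := fun x =>
    Submodule.Quotient.mk_eq_zero _
  have hf0 : ∀ x : K, f x = 0 ↔ πE1 T d F p q (toZ1 x) ∈ ⨆ r : ℕ, Bbar T d F r p q := fun x =>
    Submodule.Quotient.mk_eq_zero _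
  have hker : ∀ x, g x = 0 ↔ f x = 0 := by
    intro x
    rw [hg0, hf0]
    constructor
    · rintro ⟨y, hy, hyx⟩
      have h1 : x.1 - y ∈ comap (Zcyc T d q).subtype (Bdry T d q) :=
        (Submodule.Quotient.eq _).1 hyx.symm
      obtain ⟨w, hw⟩ := h1
      have hw' : d (q + 1) w = x.1.1 - y.1 := hw
      have hwt : w ∈ ⨆ a, F a (q + 1 + 1) := by rw [hexh]; trivial
      rw [Submodule.mem_iSup_of_directed _
        (Monotone.directed_le fun a b hab => hmono a b _ hab)] at hwt
      obtain ⟨a, ha⟩ := hwt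
      let s : ℕ := (a - p).toNat
      have has : a ≤ p + s := by have := Int.self_le_toNat (a - p); omega
      refine Submodule.mem_iSup_of_mem s ⟨toZ1 x, ?_, rfl⟩
      show x.1.1 ∈ Bpart T d F s p q
      have hx : x.1.1 = y.1 + d (q + 1) w := by rw [hw']; abel
      rw [hx]
      refine Submodule.add_mem_sup ⟨hy, ?_⟩ ⟨w, ⟨hmono _ _ _ has ha, ?_⟩, rfl⟩
      · show d q y.1 ∈ F (p - 1 - s) q
        have h0 : d q y.1 = 0 := y.2
        rw [h0]; exact zero_mem _
      · show d (q + 1) w ∈ F (p + s - s) (q + 1)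
        rw [hw', add_sub_cancel_right]
        exact sub_mem x.2 (hpp _ hy)
    · intro hx
      let L : Submodule k (T (q + 1)) := F (p - 1) (q + 1) ⊔ LinearMap.range (d (q + 1))
      have hBL : ∀ r, Bpart T d F r p q ≤ L := by
        intro r
        refine sup_le_sup inf_le_left ?_
        rintro _ ⟨w, -, rfl⟩
        exact ⟨w, rfl⟩
      have hle : (⨆ r : ℕ, Bbar T d F r p q) ≤
          map (πE1 T d F p q) (comap (Zr T d F 1 p q).subtype L) :=
        iSup_le fun r => Submodule.map_mono (Submodule.comap_mono (hBL r))
      obtain ⟨z, hz, hzx⟩ := hle hx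
      have h1 : z - toZ1 x ∈ comap (Zr T d F 1 p q).subtype (Bpart T d F 0 p q) :=
        (Submodule.Quotient.eq _).1 hzx
      have h2 : z.1 - x.1.1 ∈ L := hBL 0 h1
      have h3 : x.1.1 ∈ L := by
        have := sub_mem (show z.1 ∈ L from hz) h2
        rwa [sub_sub_cancel] at this
      obtain ⟨y, hy, _, ⟨w, rfl⟩, hyw⟩ := Submodule.mem_sup.1 h3
      have hdd : d q (d (q + 1) w) = 0 := LinearMap.congr_fun (hd q) w
      have hdx : d q x.1.1 = 0 := x.1.2
      have hdy : d q y = 0 := by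
        rw [← hyw, map_add, hdd, add_zero] at hdx
        exact hdx
      refine ⟨⟨y, hdy⟩, hy, ?_⟩
      refine ((Submodule.Quotient.eq _).2 ?_).symm
      refine ⟨w, ?_⟩
      show d (q + 1) w = x.1.1 - y
      rw [← hyw]; abel
  obtain ⟨γ, hγ, hγf⟩ := exists_factor_inj g f hg hker
  refine ⟨γ, hγ, ?_⟩
  intro x hcyc hF hFH hZ1 hZb
  exact hγf ⟨⟨x, hcyc⟩, hF⟩
end

section
/- Suppose the exact couple arising from 0 → A →^i A →^j C → 0 is bounded below, i.e. for each q there exists p(q) with A_{p,q} = 0 for all p < p(q). Then the spectral sequence converges to H_* = colim_p A_{p,*}: the natural map γ: F_p H_q / F_{p-1}H_q → E^∞_{p,q} is an isomorphism for all p,q. -/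
open Submodule

theorem exists_bij_of_ker_eq {k W M N : Type*} [CommRing k] [AddCommGroup W] [Module k W]
    [AddCommGroup M] [Module k M] [AddCommGroup N] [Module k N]
    (f : W →ₗ[k] M) (g : W →ₗ[k] N) (hf : Function.Surjective f) (hg : Function.Surjective g)
    (h : ∀ x, f x = 0 ↔ g x = 0) :
    ∃ γ : M →ₗ[k] N, Function.Bijective γ ∧ ∀ x, γ (f x) = g x := by
  have hk : LinearMap.ker f = LinearMap.ker g := by
    ext x; simpa using h x
  refine ⟨((f.quotKerEquivOfSurjective hf).symm.trans ((Submodule.quotEquivOfEq _ _ hk).trans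
    (g.quotKerEquivOfSurjective hg))).toLinearMap, LinearEquiv.bijective _, fun x => ?_⟩
  have : (f.quotKerEquivOfSurjective hf).symm (f x) = Submodule.Quotient.mk x := by
    rw [LinearEquiv.symm_apply_eq]; rfl
  simp only [LinearEquiv.coe_coe, LinearEquiv.trans_apply, this]
  rfl

/-- Suppose the exact couple arising from `0 → A →ⁱ A →ʲ C → 0` — here
presented, using injectivity of `i`, as an exhaustive filtration `F` of the colimit
complex `T` — is bounded below: for each `q` there is `p(q)` with `A_{p,q} = 0`
(`F_p T_q = ⊥`) for all `p < p(q)`.  Then the spectral sequence converges to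
`H_* = colim_p A_{p,*}`: the natural map `γ : F_p H_q / F_{p-1} H_q → E^∞_{p,q}` is an
isomorphism for all `p, q`. -/
theorem stmt_10 {k : Type*} [CommRing k]
    (T : ℤ → Type*) [∀ q, AddCommGroup (T q)] [∀ q, Module k (T q)]
    (d : ∀ q : ℤ, T (q + 1) →ₗ[k] T q)
    (hd : ∀ q, (d q) ∘ₗ (d (q + 1)) = 0)
    (F : ℤ → ∀ q : ℤ, Submodule k (T q))
    (hmono : ∀ p p' q, p ≤ p' → F p q ≤ F p' q)
    (hexh : ∀ q, (⨆ p, F p q) = ⊤)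
    (hcompat : ∀ p q x, x ∈ F p (q + 1) → d q x ∈ F p q)
    -- bounded below
    (hbdd : ∀ q, ∃ p₀ : ℤ, ∀ p < p₀, F p q = ⊥)
    (p q : ℤ) :
    ∃ γ : (↥(FH T d F p q) ⧸ comap (FH T d F p q).subtype (FH T d F (p - 1) q))
        →ₗ[k] Einf T d F p q,
      Function.Bijective γ ∧
      ∀ (x : T (q + 1)) (hcyc : x ∈ Zcyc T d q) (hF : x ∈ F p (q + 1))
        (hFH : (πH T d q ⟨x, hcyc⟩) ∈ FH T d F p q)
        (hZ1 : x ∈ Zr T d F 1 p q)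
        (hZb : (πE1 T d F p q ⟨x, hZ1⟩) ∈ ⨅ r : ℕ, Zbar T d F r p q),
        γ (Submodule.Quotient.mk ⟨πH T d q ⟨x, hcyc⟩, hFH⟩) =
          Submodule.Quotient.mk ⟨πE1 T d F p q ⟨x, hZ1⟩, hZb⟩ := by
  have hdd : ∀ q x, d q (d (q + 1) x) = 0 := fun q x => LinearMap.congr_fun (hd q) x
  have hWZ : ∀ r : ℕ, Zcyc T d q ⊓ F p (q + 1) ≤ Zr T d F r p q := by
    intro r x hx
    refine ⟨hx.2, ?_⟩
    have h0 : d q x = 0 := hx.1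
    simp [h0]
  have hFHmem : ∀ x : ↥(Zcyc T d q ⊓ F p (q + 1)),
      ((πH T d q) ∘ₗ Submodule.inclusion inf_le_left) x ∈ FH T d F p q := by
    intro x
    exact ⟨⟨x.1, x.2.1⟩, x.2.2, rfl⟩
  have hZmem : ∀ x : ↥(Zcyc T d q ⊓ F p (q + 1)),
      ((πE1 T d F p q) ∘ₗ Submodule.inclusion (hWZ 1)) x ∈ ⨅ r : ℕ, Zbar T d F r p q := by
    intro x
    rw [Submodule.mem_iInf]
    intro r
    exact ⟨⟨x.1, hWZ 1 x.2⟩, hWZ (r + 1) x.2, rfl⟩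
  -- the union of the boundaries
  have hsup : ∀ x : ↥(Zr T d F 1 p q), πE1 T d F p q x ∈ (⨆ r : ℕ, Bbar T d F r p q) ↔
      x.1 ∈ F (p - 1) (q + 1) ⊔ Bdry T d q := by
    intro x
    constructor
    · intro hx
      have hle : (⨆ r : ℕ, Bbar T d F r p q) ≤ map (πE1 T d F p q)
          (comap (Zr T d F 1 p q).subtype (F (p - 1) (q + 1) ⊔ Bdry T d q)) := by
        refine iSup_le fun r => Submodule.map_mono (Submodule.comap_mono ?_)
        refine sup_le_sup inf_le_left ?_
        rintro _ ⟨z, -, rfl⟩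
        exact ⟨z, rfl⟩
      obtain ⟨y, hy, hxy⟩ := hle hx
      have h1 : y - x ∈ comap (Zr T d F 1 p q).subtype (Bpart T d F 0 p q) :=
        (Submodule.Quotient.eq _).1 hxy
      have h2 : (y - x).1 ∈ F (p - 1) (q + 1) ⊔ Bdry T d q := by
        refine (sup_le_sup inf_le_left ?_ : Bpart T d F 0 p q ≤ _) h1
        rintro _ ⟨z, -, rfl⟩
        exact ⟨z, rfl⟩
      have h3 : x.1 = y.1 - (y - x).1 := by simp
      rw [h3]
      exact Submodule.sub_mem _ hy h2
    · intro hx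
      obtain ⟨y, hy, _, ⟨z, rfl⟩, hxy⟩ := Submodule.mem_sup.1 hx
      have hdz : d (q + 1) z ∈ F p (q + 1) := by
        have : d (q + 1) z = x.1 - y := by rw [← hxy]; simp
        rw [this]
        exact Submodule.sub_mem _ x.2.1 (hmono _ _ _ (by omega) hy)
      have hz : z ∈ ⨆ s, F s (q + 1 + 1) := by rw [hexh]; trivial
      rw [Submodule.mem_iSup_of_directed _ (fun a b => ⟨max a b,
        hmono _ _ _ (le_max_left _ _), hmono _ _ _ (le_max_right _ _)⟩)] at hz
      obtain ⟨s, hs⟩ := hz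
      have hzr : d (q + 1) z ∈ Bpart T d F (s - p).toNat p q := by
        refine Submodule.mem_sup_right ⟨z, ⟨hmono _ _ _ (by omega) hs, ?_⟩, rfl⟩
        exact hmono _ _ _ (by omega) hdz
      have hdz1 : d (q + 1) z ∈ Zr T d F 1 p q := hWZ 1 ⟨hdd q z, hdz⟩
      have hEq : πE1 T d F p q x = πE1 T d F p q ⟨d (q + 1) z, hdz1⟩ := by
        refine (Submodule.Quotient.eq _).2 ?_
        refine Submodule.mem_sup_left ?_
        have : (x - ⟨d (q + 1) z, hdz1⟩ : ↥(Zr T d F 1 p q)).1 = y := by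
          simp [← hxy]
        change (x - ⟨d (q + 1) z, hdz1⟩ : ↥(Zr T d F 1 p q)).1 ∈ _
        rw [this]
        refine ⟨hy, ?_⟩
        have := hcompat _ _ _ hy
        simpa using this
      rw [hEq]
      exact Submodule.mem_iSup_of_mem (s - p).toNat ⟨_, hzr, rfl⟩
  -- the kernel on the homology side
  have hker : ∀ (x : T (q + 1)) (hx : x ∈ Zcyc T d q), πH T d q ⟨x, hx⟩ ∈ FH T d F (p - 1) q ↔
      x ∈ F (p - 1) (q + 1) ⊔ Bdry T d q := by
    intro x hx
    constructor
    · rintro ⟨y, hy, hxy⟩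
      have h1 : y - ⟨x, hx⟩ ∈ comap (Zcyc T d q).subtype (Bdry T d q) :=
        (Submodule.Quotient.eq _).1 hxy
      have h2 : y.1 - x ∈ Bdry T d q := h1
      have h3 : x = y.1 - (y.1 - x) := by simp
      rw [h3]
      exact Submodule.sub_mem _ (Submodule.mem_sup_left hy) (Submodule.mem_sup_right h2)
    · intro h
      obtain ⟨y, hy, _, ⟨z, rfl⟩, hxy⟩ := Submodule.mem_sup.1 h
      have hyc : y ∈ Zcyc T d q := by
        have : y = x - d (q + 1) z := by rw [← hxy]; simp
        rw [this]
        exact Submodule.sub_mem _ hx (hdd q z)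
      refine ⟨⟨y, hyc⟩, hy, (Submodule.Quotient.eq _).2 ?_⟩
      change y - x ∈ Bdry T d q
      refine ⟨-z, ?_⟩
      rw [← hxy]; simp
  obtain ⟨γ, hγ, hγ'⟩ := exists_bij_of_ker_eq
    ((comap (FH T d F p q).subtype (FH T d F (p - 1) q)).mkQ ∘ₗ
      LinearMap.codRestrict (FH T d F p q) _ hFHmem)
    ((comap (⨅ r : ℕ, Zbar T d F r p q).subtype (⨆ r : ℕ, Bbar T d F r p q)).mkQ ∘ₗ
      LinearMap.codRestrict (⨅ r : ℕ, Zbar T d F r p q) _ hZmem)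
    (by
      intro m
      obtain ⟨⟨_, ⟨y, hy, rfl⟩⟩, rfl⟩ := Submodule.mkQ_surjective _ m
      exact ⟨⟨y.1, y.2, hy⟩, rfl⟩)
    (by
      intro m
      obtain ⟨⟨e, he⟩, rfl⟩ := Submodule.mkQ_surjective _ m
      obtain ⟨p₀, hp₀⟩ := hbdd q
      obtain ⟨y, hy, rfl⟩ := (Submodule.mem_iInf _).1 he (p - p₀).toNat
      have hy2 : d q y.1 ∈ F (p - (((p - p₀).toNat + 1 : ℕ) : ℤ)) q := hy.2
      rw [hp₀ _ (by push_cast; omega)] at hy2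
      exact ⟨⟨y.1, (Submodule.mem_bot k).1 hy2, y.2.1⟩, rfl⟩)
    (by
      intro x
      refine Iff.trans (Submodule.Quotient.mk_eq_zero _) ?_
      refine Iff.trans ?_ (Submodule.Quotient.mk_eq_zero _).symm
      exact (hker x.1 x.2.1).trans (hsup ⟨x.1, hWZ 1 x.2⟩).symm)
  exact ⟨γ, hγ, fun x hcyc hF _ _ _ => hγ' ⟨x, hcyc, hF⟩⟩
end
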